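/- Let q ≥ 2 be an integer and let G be a (q+1)-regular tree. For every integer N ≥ 3 there exists a constant C(N) > 0 (depending only on N and q) with the following property: for every constant C_A ≥ 0 and every kernel K : V × V → ℂ satisfying |K(x,y)| ≤ C_A · q^{−d(x,y)/2}/(1+d(x,y))^N for all x, y ∈ V, and every finitely supported function φ : V → ℂ, the function x ↦ Σ_{y ∈ V} K(x,y) φ(y) is square-summable and satisfies (Σ_{x ∈ V} |Σ_{y ∈ V} K(x,y) φ(y)|²)^{1/2} ≤ C(N)·C_A·(Σ_{y ∈ V} |φ(y)|²)^{1/2}. In particular the operator with kernel K extends to a bounded operator on ℓ²(V) of norm at most C(N)·C_A. -/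

import Mathlib

open Finset

lemma summable_two_div_add_one_sq : Summable fun n : ℕ => 2 / ((n : ℝ) + 1) ^ 2 := by
  have := ((summable_nat_add_iff 1).mpr
    (Real.summable_one_div_nat_pow.mpr one_lt_two)).mul_left 2
  simpa [div_eq_mul_inv] using this

namespace SimpleGraph

variable {V : Type*} {G : SimpleGraph V}

/-- On a geodesic from `x` to `y` of positive length, the first step is a neighbour of `x` that is
one step closer to `y`. -/
lemma Connected.exists_adj_dist_eq (hG : G.Connected) {x y : V} {n : ℕ}
    (h : G.dist x y = n + 1) : ∃ z, G.Adj x z ∧ G.dist z y = n := by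
  obtain ⟨p, hp⟩ := hG.exists_walk_length_eq_dist x y
  cases p with
  | nil => simp at h
  | @cons _ z _ hxz p =>
    refine ⟨z, hxz, ?_⟩
    have h₁ := dist_le p
    have h₂ := hG.dist_triangle (u := x) (v := z) (w := y)
    rw [dist_eq_one_iff_adj.mpr hxz] at h₂
    simp only [Walk.length_cons] at hp
    omega

/-- In a tree, a vertex has at most one neighbour closer to a given root. -/
lemma IsTree.eq_of_adj_of_dist_eq (hG : G.IsTree) {o x u v : V} (hu : G.Adj x u)
    (hv : G.Adj x v) (hu' : G.dist o x = G.dist o u + 1) (hv' : G.dist o x = G.dist o v + 1) :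
    u = v := by
  obtain ⟨p, hp⟩ := hG.connected.exists_walk_length_eq_dist u o
  obtain ⟨r, hr⟩ := hG.connected.exists_walk_length_eq_dist v o
  have hp' : (Walk.cons hu p).IsPath := Walk.isPath_of_length_eq_dist _ (by
    rw [Walk.length_cons, hp, dist_comm, dist_comm (u := x), hu'])
  have hr' : (Walk.cons hv r).IsPath := Walk.isPath_of_length_eq_dist _ (by
    rw [Walk.length_cons, hr, dist_comm, dist_comm (u := x), hv'])
  have h := (hG.existsUnique_path x o).unique hp' hr'
  simpa using congrArg Walk.snd h

end SimpleGraph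

/-- If the sets `Q z`, `z ∈ S`, cover `P`, then a nonnegative weighted sum over `P` is
at most the sum of the weighted sums over the pieces. -/
lemma Finset.sum_filter_le_sum_sum_filter {ι κ : Type*} (F : Finset ι) (S : Finset κ)
    (P : ι → Prop) (Q : κ → ι → Prop) [DecidablePred P] [∀ z, DecidablePred (Q z)]
    {w : ι → ℝ} (hw : ∀ y, 0 ≤ w y) (h : ∀ y, P y → ∃ z ∈ S, Q z y) :
    ∑ y ∈ F with P y, w y ≤ ∑ z ∈ S, ∑ y ∈ F with Q z y, w y := by
  simp only [sum_filter]
  rw [sum_comm]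
  refine sum_le_sum fun y _ => ?_
  have hnn : ∀ z ∈ S, 0 ≤ if Q z y then w y else 0 := fun z _ => by
    split_ifs <;> simp [hw]
  split_ifs with hP
  · obtain ⟨z, hz, hQ⟩ := h y hP
    exact (if_pos hQ).ge.trans (single_le_sum hnn hz)
  · exact sum_nonneg hnn

namespace SimpleGraph

variable {V : Type*} {G : SimpleGraph V} {q : ℕ} {t : ℝ}

/-- The sum of the weights `t ^ (-dist o y)` over the vertices `y` of `F` at distance `n` from `x`
that lie in the branch at `x` pointing away from the neighbour `p`. -/
noncomputable def branchSum (G : SimpleGraph V) (t : ℝ) (o : V) (F : Finset V) (n : ℕ) (p x : V) :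
    ℝ :=
  ∑ y ∈ F with G.dist x y = n ∧ G.dist p y = n + 1, t⁻¹ ^ G.dist o y

lemma Connected.sum_dist_eq_zero_le (hG : G.Connected) (ht : 0 < t) (o : V) (F : Finset V)
    (x : V) (P : V → Prop) [DecidablePred P] (hP : ∀ y, P y → G.dist x y = 0) :
    ∑ y ∈ F with P y, t⁻¹ ^ G.dist o y ≤ t⁻¹ ^ G.dist o x := by
  have hsub : F.filter P ⊆ {x} := fun y hy => by
    have := hG.dist_eq_zero_iff.mp (hP y (mem_filter.mp hy).2)
    simp [this]
  refine (sum_le_sum_of_subset_of_nonneg hsub fun y _ _ => by positivity).trans ?_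
  simp

lemma Connected.branchSum_succ_le [DecidableEq V] (hG : G.Connected) (ht : 0 < t) (o : V)
    (F : Finset V) {nb : V → Finset V} (hnb : ∀ x y, y ∈ nb x ↔ G.Adj x y) (n : ℕ) (p x : V) :
    G.branchSum t o F (n + 1) p x ≤ ∑ z ∈ (nb x).erase p, G.branchSum t o F n x z := by
  refine sum_filter_le_sum_sum_filter F _ _ _ (fun y => by positivity) fun y hy => ?_
  obtain ⟨z, hxz, hz⟩ := hG.exists_adj_dist_eq hy.1
  refine ⟨z, mem_erase.mpr ⟨?_, (hnb x z).mpr hxz⟩, hz, hy.1⟩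
  rintro rfl
  omega

/-- Bound for branches pointing away from the root. -/
lemma IsTree.branchSum_le_of_away (hG : G.IsTree) (ht : 0 < t) (htq : t ^ 2 = q) (o : V)
    (F : Finset V) {nb : V → Finset V} (hnb : ∀ x y, y ∈ nb x ↔ G.Adj x y)
    (hcard : ∀ x, (nb x).card = q + 1) (n : ℕ) {p x : V} (hpx : G.Adj p x)
    (hd : G.dist o x = G.dist o p + 1) :
    G.branchSum t o F n p x ≤ t ^ n * t⁻¹ ^ G.dist o x := by
  classical
  induction n generalizing p x with
  | zero =>
    rw [pow_zero, one_mul]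
    exact hG.connected.sum_dist_eq_zero_le ht o F x _ fun y hy => hy.1
  | succ n ih =>
    refine (hG.connected.branchSum_succ_le ht o F hnb n p x).trans ?_
    have hz : ∀ z ∈ (nb x).erase p,
        G.branchSum t o F n x z ≤ t ^ n * t⁻¹ ^ (G.dist o x + 1) := fun z hz => by
      rw [mem_erase, hnb] at hz
      have hd' : G.dist o z = G.dist o x + 1 := by
        rcases hG.dist_eq_dist_add_one_of_adj o hz.2 with h | h
        · exact absurd (hG.eq_of_adj_of_dist_eq hz.2 hpx.symm h hd) hz.1
        · exact h
      exact (ih hz.2 hd').trans_eq (by rw [hd'])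
    refine (sum_le_card_nsmul _ _ _ hz).trans_eq ?_
    rw [card_erase_of_mem ((hnb x p).mpr hpx.symm), hcard, Nat.add_sub_cancel, nsmul_eq_mul,
      ← htq, pow_succ t⁻¹, pow_succ t n]
    field_simp

/-- Summing branch bounds over neighbours: at most one neighbour lies towards the root. -/
lemma IsTree.sum_branchSum_le (hG : G.IsTree) (ht : 0 < t) (htq : t ^ 2 = q) (o : V)
    (F : Finset V) {nb : V → Finset V} (hnb : ∀ x y, y ∈ nb x ↔ G.Adj x y)
    (hcard : ∀ x, (nb x).card = q + 1) (n : ℕ) {x : V}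
    (hbranch : ∀ z, G.Adj x z →
      G.branchSum t o F n x z ≤ (n + 1) * t ^ n * t⁻¹ ^ G.dist o z)
    {S : Finset V} (hS : S ⊆ nb x) {c : ℕ} (hc : S.card ≤ c) :
    ∑ z ∈ S, G.branchSum t o F n x z ≤
      c * (t ^ n * t⁻¹ ^ (G.dist o x + 1)) + (n + 1) * t ^ (n + 1) * t⁻¹ ^ G.dist o x := by
  classical
  rw [← sum_filter_add_sum_filter_not S (fun z => G.dist o z = G.dist o x + 1)]
  refine add_le_add ?_ ?_
  · refine (sum_le_card_nsmul _ _ (t ^ n * t⁻¹ ^ (G.dist o x + 1)) fun z hz => ?_).trans ?_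
    · obtain ⟨hzS, hz⟩ := mem_filter.mp hz
      have := hG.branchSum_le_of_away ht htq o F hnb hcard n ((hnb x z).mp (hS hzS)) hz
      rwa [hz] at this
    · rw [nsmul_eq_mul]
      gcongr
      exact (card_filter_le _ _).trans hc
  · have hpar : ∀ z ∈ S.filter (fun z => ¬ G.dist o z = G.dist o x + 1),
        G.Adj x z ∧ G.dist o x = G.dist o z + 1 := fun z hz => by
      obtain ⟨hzS, hz⟩ := mem_filter.mp hz
      have hadj := (hnb x z).mp (hS hzS)
      exact ⟨hadj, (hG.dist_eq_dist_add_one_of_adj o hadj).resolve_right hz⟩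
    refine (sum_le_card_nsmul _ _ ((n + 1) * t ^ (n + 1) * t⁻¹ ^ G.dist o x)
      fun z hz => ?_).trans ?_
    · obtain ⟨hadj, hz⟩ := hpar z hz
      refine (hbranch z hadj).trans_eq ?_
      rw [hz, pow_succ t⁻¹, pow_succ t n]
      field_simp
    · have h1 : (S.filter (fun z => ¬ G.dist o z = G.dist o x + 1)).card ≤ 1 :=
        card_le_one.mpr fun a ha b hb =>
          hG.eq_of_adj_of_dist_eq (hpar a ha).1 (hpar b hb).1 (hpar a ha).2 (hpar b hb).2
      rw [nsmul_eq_mul]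
      refine mul_le_of_le_one_left (by positivity) (by exact_mod_cast h1)

/-- Bound for arbitrary branches. -/
lemma IsTree.branchSum_le (hG : G.IsTree) (ht : 0 < t) (htq : t ^ 2 = q) (o : V)
    (F : Finset V) {nb : V → Finset V} (hnb : ∀ x y, y ∈ nb x ↔ G.Adj x y)
    (hcard : ∀ x, (nb x).card = q + 1) (n : ℕ) {p x : V} (hpx : G.Adj p x) :
    G.branchSum t o F n p x ≤ (n + 1) * t ^ n * t⁻¹ ^ G.dist o x := by
  classical
  induction n generalizing p x with
  | zero =>
    rw [Nat.cast_zero, zero_add, pow_zero, one_mul, one_mul]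
    exact hG.connected.sum_dist_eq_zero_le ht o F x _ fun y hy => hy.1
  | succ n ih =>
    refine (hG.connected.branchSum_succ_le ht o F hnb n p x).trans ?_
    have hc : ((nb x).erase p).card ≤ q := by
      rw [card_erase_of_mem ((hnb x p).mpr hpx.symm), hcard, Nat.add_sub_cancel]
    refine (hG.sum_branchSum_le ht htq o F hnb hcard n (fun z hz => ih hz)
      (erase_subset _ _) hc).trans_eq ?_
    rw [← htq, pow_succ t⁻¹, pow_succ t n]
    push_cast
    field_simp
    ring

/-- On a `(q+1)`-regular tree with `t = √q`, the weight `t ^ (-dist o y)` summed over the sphere of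
radius `n` around `x` is at most `2 (n + 1) t ^ n` times the weight of `x`. -/
lemma IsTree.sum_sphere_le (hG : G.IsTree) (hq : 1 ≤ q) (ht : 0 < t) (htq : t ^ 2 = q) (o : V)
    (F : Finset V) {nb : V → Finset V} (hnb : ∀ x y, y ∈ nb x ↔ G.Adj x y)
    (hcard : ∀ x, (nb x).card = q + 1) (n : ℕ) (x : V) :
    ∑ y ∈ F with G.dist x y = n, t⁻¹ ^ G.dist o y ≤
      2 * (n + 1) * t ^ n * t⁻¹ ^ G.dist o x := by
  classical
  have hw : 0 < t⁻¹ ^ G.dist o x := by positivity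
  cases n with
  | zero =>
    refine (hG.connected.sum_dist_eq_zero_le ht o F x _ fun y hy => hy).trans ?_
    simp only [Nat.cast_zero, zero_add, pow_zero, mul_one]
    linarith
  | succ n =>
    refine (sum_filter_le_sum_sum_filter F (nb x) _
      (fun z y => G.dist z y = n ∧ G.dist x y = n + 1) (fun y => by positivity)
      fun y hy => ?_).trans ?_
    · obtain ⟨z, hxz, hz⟩ := hG.connected.exists_adj_dist_eq hy
      exact ⟨z, (hnb x z).mpr hxz, hz, hy⟩
    · refine (hG.sum_branchSum_le ht htq o F hnb hcard n
        (fun z hz => hG.branchSum_le ht htq o F hnb hcard n hz)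
        subset_rfl (c := 2 * q) (by rw [hcard]; omega)).trans ?_
      have heq : ((2 * q : ℕ) : ℝ) * (t ^ n * t⁻¹ ^ (G.dist o x + 1)) =
          2 * (t ^ (n + 1) * t⁻¹ ^ G.dist o x) := by
        push_cast
        rw [← htq, pow_succ t⁻¹, pow_succ t n]
        field_simp
      have hpos : 0 < t ^ (n + 1) * t⁻¹ ^ G.dist o x := by positivity
      rw [heq]
      push_cast
      nlinarith [mul_nonneg n.cast_nonneg hpos.le]

/-- The weight `t ^ (-dist o y)` is a Schur test function for the kernel
`t ^ (-dist x y) / (1 + dist x y) ^ N`. -/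
lemma IsTree.sum_kernel_le (hG : G.IsTree) (hq : 1 ≤ q) (ht : 0 < t) (htq : t ^ 2 = q) (o : V)
    (F : Finset V) {nb : V → Finset V} (hnb : ∀ x y, y ∈ nb x ↔ G.Adj x y)
    (hcard : ∀ x, (nb x).card = q + 1) {N : ℕ} (hN : 3 ≤ N) (x : V) :
    ∑ y ∈ F, t⁻¹ ^ G.dist x y / (1 + (G.dist x y : ℝ)) ^ N * t⁻¹ ^ G.dist o y ≤
      (∑' n : ℕ, 2 / ((n : ℝ) + 1) ^ 2) * t⁻¹ ^ G.dist o x := by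
  classical
  rw [← sum_fiberwise_of_maps_to (g := fun y => G.dist x y)
    (t := F.image fun y => G.dist x y) fun y hy => mem_image_of_mem _ hy]
  have hfib : ∀ n ∈ F.image (fun y => G.dist x y),
      ∑ y ∈ F with G.dist x y = n,
        t⁻¹ ^ G.dist x y / (1 + (G.dist x y : ℝ)) ^ N * t⁻¹ ^ G.dist o y ≤
      2 / ((n : ℝ) + 1) ^ 2 * t⁻¹ ^ G.dist o x := fun n _ => by
    have hconst : ∑ y ∈ F with G.dist x y = n,
        t⁻¹ ^ G.dist x y / (1 + (G.dist x y : ℝ)) ^ N * t⁻¹ ^ G.dist o y =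
        t⁻¹ ^ n / (1 + (n : ℝ)) ^ N * ∑ y ∈ F with G.dist x y = n, t⁻¹ ^ G.dist o y := by
      rw [mul_sum]
      refine sum_congr rfl fun y hy => ?_
      rw [(mem_filter.mp hy).2]
    rw [hconst]
    have hpow : (1 + (n : ℝ)) ^ 3 ≤ (1 + (n : ℝ)) ^ N :=
      pow_le_pow_right₀ (by linarith [n.cast_nonneg (α := ℝ)]) hN
    calc t⁻¹ ^ n / (1 + (n : ℝ)) ^ N * ∑ y ∈ F with G.dist x y = n, t⁻¹ ^ G.dist o y
        ≤ t⁻¹ ^ n / (1 + (n : ℝ)) ^ 3 * (2 * (n + 1) * t ^ n * t⁻¹ ^ G.dist o x) := by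
          gcongr
          exact hG.sum_sphere_le hq ht htq o F hnb hcard n x
      _ = 2 / ((n : ℝ) + 1) ^ 2 * t⁻¹ ^ G.dist o x := by
          rw [add_comm (1 : ℝ), inv_pow t n]
          field_simp
  refine (sum_le_sum hfib).trans ?_
  rw [← sum_mul]
  gcongr
  exact summable_two_div_add_one_sq.sum_le_tsum _ fun n _ => by positivity

end SimpleGraph

/-- **Schur test** on finite sets for a symmetric nonnegative kernel. -/
lemma sum_sq_norm_sum_mul_le_of_schur {V : Type*} {k : V → V → ℝ} (hk : ∀ x y, 0 ≤ k x y)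
    (hsymm : ∀ x y, k x y = k y x) {w : V → ℝ} (hw : ∀ x, 0 < w x) {B : ℝ} (hB : 0 ≤ B)
    (hschur : ∀ (F : Finset V) (x : V), ∑ y ∈ F, k x y * w y ≤ B * w x)
    {K : V → V → ℂ} (hK : ∀ x y, ‖K x y‖ ≤ k x y) (φ : V → ℂ) (E F : Finset V) :
    ∑ x ∈ E, ‖∑ y ∈ F, K x y * φ y‖ ^ 2 ≤ B ^ 2 * ∑ y ∈ F, ‖φ y‖ ^ 2 := by
  have hrow : ∀ x ∈ E, ‖∑ y ∈ F, K x y * φ y‖ ^ 2 ≤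
      ∑ y ∈ F, B * (‖φ y‖ ^ 2 / w y) * (k y x * w x) := fun x _ => by
    calc ‖∑ y ∈ F, K x y * φ y‖ ^ 2 ≤ (∑ y ∈ F, k x y * ‖φ y‖) ^ 2 := by
          gcongr
          refine (norm_sum_le _ _).trans (sum_le_sum fun y _ => ?_)
          rw [norm_mul]
          gcongr
          exact hK x y
      _ ≤ (∑ y ∈ F, k x y * w y) * ∑ y ∈ F, k x y * (‖φ y‖ ^ 2 / w y) := by
          refine sum_sq_le_sum_mul_sum_of_sq_le_mul F
            (fun y _ => mul_nonneg (hk x y) (hw y).le)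
            (fun y _ => mul_nonneg (hk x y) (div_nonneg (sq_nonneg _) (hw y).le))
            fun y _ => le_of_eq ?_
          have := (hw y).ne'
          field_simp
      _ ≤ (B * w x) * ∑ y ∈ F, k x y * (‖φ y‖ ^ 2 / w y) := by
          refine mul_le_mul_of_nonneg_right (hschur F x) (sum_nonneg fun y _ => ?_)
          exact mul_nonneg (hk x y) (div_nonneg (sq_nonneg _) (hw y).le)
      _ = ∑ y ∈ F, B * (‖φ y‖ ^ 2 / w y) * (k y x * w x) := by
          rw [mul_sum]
          refine sum_congr rfl fun y _ => ?_
          rw [hsymm x y]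
          ring
  refine (sum_le_sum hrow).trans ?_
  rw [sum_comm, mul_sum]
  refine sum_le_sum fun y _ => ?_
  rw [← mul_sum]
  have hy := hw y
  calc B * (‖φ y‖ ^ 2 / w y) * ∑ x ∈ E, k y x * w x
      ≤ B * (‖φ y‖ ^ 2 / w y) * (B * w y) := by
        gcongr
        exact hschur E y
    _ = B ^ 2 * ‖φ y‖ ^ 2 := by field_simp


/-- For every `N ≥ 3` and `q ≥ 2` there is `C = C(N,q) > 0` such that on any
`(q+1)`-regular tree, any kernel satisfying the rapid decay bound
`|K(x,y)| ≤ C_A · q^{−d(x,y)/2}/(1+d(x,y))^N` defines an operator bounded on `ℓ²(V)`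
with norm at most `C·C_A`. -/
theorem kernel_decay_L2_bounded (q : ℕ) (hq : 2 ≤ q) (N : ℕ) (hN : 3 ≤ N) :
    ∃ C : ℝ, 0 < C ∧
      ∀ (V : Type) (G : SimpleGraph V), G.IsTree →
        (∀ v : V, (G.neighborSet v).ncard = q + 1) →
        ∀ (CA : ℝ), 0 ≤ CA → ∀ (K : V → V → ℂ),
        (∀ x y : V, ‖K x y‖ ≤
          CA * (q : ℝ) ^ (-(G.dist x y : ℝ) / 2) / (1 + (G.dist x y : ℝ)) ^ N) →
        ∀ φ : V → ℂ, (Function.support φ).Finite →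
          Summable (fun x : V => ‖∑' y : V, K x y * φ y‖ ^ 2) ∧
          Real.sqrt (∑' x : V, ‖∑' y : V, K x y * φ y‖ ^ 2) ≤
            C * CA * Real.sqrt (∑' y : V, ‖φ y‖ ^ 2) := by
  set C : ℝ := ∑' n : ℕ, 2 / ((n : ℝ) + 1) ^ 2 with hC
  have hCpos : 0 < C := summable_two_div_add_one_sq.tsum_pos (fun n => by positivity) 0 (by norm_num)
  refine ⟨C, hCpos, fun V G hG hdeg CA hCA K hK φ hφ => ?_⟩
  have hq0 : (0 : ℝ) < q := by exact_mod_cast (by omega : 0 < q)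
  set t : ℝ := Real.sqrt q with ht
  have htpos : 0 < t := Real.sqrt_pos.mpr hq0
  have htq : t ^ 2 = q := Real.sq_sqrt hq0.le
  have hfin : ∀ v, (G.neighborSet v).Finite := fun v =>
    Set.finite_of_ncard_pos (by rw [hdeg v]; omega)
  have hnb : ∀ x y, y ∈ (hfin x).toFinset ↔ G.Adj x y := fun x y => by simp
  have hcard : ∀ x, (hfin x).toFinset.card = q + 1 := fun x => by
    rw [← Set.ncard_eq_toFinset_card _ (hfin x), hdeg]
  have hpow : ∀ d : ℕ, (q : ℝ) ^ (-(d : ℝ) / 2) = t⁻¹ ^ d := fun d => by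
    rw [ht, Real.sqrt_eq_rpow, ← Real.rpow_neg hq0.le, ← Real.rpow_mul_natCast hq0.le]
    congr 1
    ring
  obtain ⟨o⟩ := hG.connected.nonempty
  have htsum : ∀ x, ∑' y, K x y * φ y = ∑ y ∈ hφ.toFinset, K x y * φ y := fun x =>
    tsum_eq_sum fun y hy => by
      have : φ y = 0 := by simpa using hy
      simp [this]
  have hφsum : ∑' y, ‖φ y‖ ^ 2 = ∑ y ∈ hφ.toFinset, ‖φ y‖ ^ 2 :=
    tsum_eq_sum fun y hy => by
      have : φ y = 0 := by simpa using hy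
      simp [this]
  have hbound : ∀ E : Finset V, ∑ x ∈ E, ‖∑' y, K x y * φ y‖ ^ 2 ≤
      (C * CA) ^ 2 * ∑' y, ‖φ y‖ ^ 2 := fun E => by
    simp only [htsum, hφsum]
    refine sum_sq_norm_sum_mul_le_of_schur
      (k := fun x y => CA * (t⁻¹ ^ G.dist x y / (1 + (G.dist x y : ℝ)) ^ N))
      (w := fun y => t⁻¹ ^ G.dist o y) (fun x y => by positivity)
      (fun x y => by rw [SimpleGraph.dist_comm]) (fun x => by positivity) (by positivity)
      (fun F x => ?_) (fun x y => ?_) φ E hφ.toFinset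
    · have := mul_le_mul_of_nonneg_left
        (hG.sum_kernel_le (by omega : 1 ≤ q) htpos htq o F hnb hcard hN x) hCA
      simp only [mul_assoc, ← mul_sum]
      refine this.trans_eq ?_
      rw [← hC]
      ring
    · have := hK x y
      rwa [hpow, mul_div_assoc] at this
  refine ⟨summable_of_sum_le (fun x => sq_nonneg _) hbound, ?_⟩
  rw [← Real.sqrt_sq (mul_nonneg hCpos.le hCA), ← Real.sqrt_mul (sq_nonneg _)]
  exact Real.sqrt_le_sqrt (Real.tsum_le_of_sum_le (fun x => sq_nonneg _) hbound)
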